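/- arXiv:2501.05696 — 5 statements merged into one kernel-verified Lean document; each statement's English description precedes it below -/
import Mathlib

section
/- Let λ be a real number and let α, n be integers with 1 ≤ α ≤ n. Then α!·{n brace α}_{−λ} = ∑_{j=α}^{n} (−1)^{n−j} · j! · {n brace j}_λ · C(j−1, α−1). -/
/-- The degenerate falling factorial `(x)_{n,λ} = x(x-λ)⋯(x-(n-1)λ)`. -/
noncomputable def dff (lam x : ℝ) (n : ℕ) : ℝ := ∏ i ∈ Finset.range n, (x - i * lam)

/-- The degenerate Stirling number of the second kind
`{n brace k}_λ = (1/k!) ∑_{j=0}^{k} C(k,j) (-1)^{k-j} (j)_{n,λ}`. -/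
noncomputable def dstirling (lam : ℝ) (n k : ℕ) : ℝ :=
  (1 / (k.factorial : ℝ)) *
    ∑ j ∈ Finset.range (k + 1), (k.choose j : ℝ) * (-1) ^ (k - j) * dff lam (j : ℝ) n

/-- The generalized binomial coefficient `C(x,m) = x(x-1)⋯(x-m+1)/m!` with real upper argument. -/
noncomputable def gchoose (x : ℝ) (m : ℕ) : ℝ := (∏ i ∈ Finset.range m, (x - i)) / m.factorial

/-- Generalized binomial coefficient with integer lower argument; zero when the lower
argument is negative. -/
noncomputable def gchooseZ (x : ℝ) (m : ℤ) : ℝ := if 0 ≤ m then gchoose x m.toNat else 0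

/-- `k! * {n brace k}_λ` is the `k`-th forward difference of `(x)_{n,λ}` at `0`. -/
theorem factorial_mul_dstirling (lam : ℝ) (n k : ℕ) :
    (k.factorial : ℝ) * dstirling lam n k =
      ∑ j ∈ Finset.range (k + 1), (k.choose j : ℝ) * (-1) ^ (k - j) * dff lam (j : ℝ) n := by
  have hk : (k.factorial : ℝ) ≠ 0 := by exact_mod_cast k.factorial_ne_zero
  rw [dstirling, ← mul_assoc, mul_one_div_cancel hk, one_mul]

theorem factorial_mul_dstirling_zero_left (lam : ℝ) (k : ℕ) :
    (k.factorial : ℝ) * dstirling lam 0 k = if k = 0 then 1 else 0 := by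
  have h := add_pow (1 : ℝ) (-1) k
  rw [add_neg_cancel, zero_pow_eq] at h
  rw [factorial_mul_dstirling, h]
  refine Finset.sum_congr rfl fun j _ => ?_
  simp [dff, mul_comm]

theorem dstirling_zero_right (lam : ℝ) {n : ℕ} (hn : n ≠ 0) : dstirling lam n 0 = 0 := by
  obtain ⟨m, rfl⟩ := Nat.exists_eq_succ_of_ne_zero hn
  simp [dstirling, dff, Finset.prod_range_succ']

theorem factorial_mul_dstirling_succ_succ (lam : ℝ) (n k : ℕ) :
    ((k + 1).factorial : ℝ) * dstirling lam (n + 1) (k + 1) =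
      (k + 1) * ((k.factorial : ℝ) * dstirling lam n k) +
        (k + 1 - n * lam) * (((k + 1).factorial : ℝ) * dstirling lam n (k + 1)) := by
  simp only [factorial_mul_dstirling]
  rw [Finset.sum_range_succ, Finset.sum_range_succ _ (k + 1), mul_add, Finset.mul_sum,
    Finset.mul_sum, ← add_assoc, ← Finset.sum_add_distrib]
  congr 1
  · refine Finset.sum_congr rfl fun j hj => ?_
    have hjk : j ≤ k := Nat.lt_succ_iff.mp (Finset.mem_range.mp hj)
    have hc : ((k + 1).choose j : ℝ) * (k + 1 - j) = (k + 1) * k.choose j := by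
      have h := Nat.choose_mul_succ_eq k j
      rw [← @Nat.cast_inj ℝ] at h
      push_cast [Nat.cast_sub (show j ≤ k + 1 by omega)] at h
      linarith
    have hd : dff lam (j : ℝ) (n + 1) = dff lam (j : ℝ) n * (j - n * lam) := by
      simp [dff, Finset.prod_range_succ]
    rw [hd, show k + 1 - j = (k - j) + 1 by omega, pow_succ]
    linear_combination (-1) ^ (k - j) * dff lam (j : ℝ) n * hc
  · simp [dff, Finset.prod_range_succ]
    ring

theorem dstirling_eq_zero_of_lt (lam : ℝ) {n k : ℕ} (h : n < k) : dstirling lam n k = 0 := by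
  have aux : (k.factorial : ℝ) * dstirling lam n k = 0 := by
    induction n generalizing k with
    | zero => rw [factorial_mul_dstirling_zero_left, if_neg (by omega)]
    | succ n ih =>
      obtain ⟨m, rfl⟩ := Nat.exists_eq_succ_of_ne_zero (show k ≠ 0 by omega)
      rw [Nat.succ_eq_add_one, factorial_mul_dstirling_succ_succ, ih (by omega), ih (by omega)]
      simp
  exact (mul_eq_zero.mp aux).resolve_left (by exact_mod_cast k.factorial_ne_zero)

theorem add_one_mul_choose_add_add_one_mul_choose_succ (j a : ℕ) :
    ((a : ℝ) + 1) * (j + 1).choose a + (j + 1) * j.choose a = (j + 2) * (j + 1).choose a := by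
  rcases le_or_gt a (j + 1) with h | h
  · have e := Nat.choose_mul_succ_eq j a
    rw [← @Nat.cast_inj ℝ] at e
    push_cast [Nat.cast_sub h] at e
    linear_combination e
  · simp [Nat.choose_eq_zero_of_lt h, Nat.choose_eq_zero_of_lt (show j < a by omega)]

theorem factorial_mul_dstirling_neg_lam (lam : ℝ) (n a : ℕ) :
    ((a + 1).factorial : ℝ) * dstirling (-lam) (n + 1) (a + 1) =
      ∑ j ∈ Finset.range (n + 1),
        (-1 : ℝ) ^ (n + j) * (((j + 1).factorial : ℝ) * dstirling lam (n + 1) (j + 1)) *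
          (j.choose a : ℝ) := by
  induction n generalizing a with
  | zero =>
    simp only [zero_add, Finset.sum_range_one, factorial_mul_dstirling_succ_succ _ 0,
      factorial_mul_dstirling_zero_left]
    cases a <;> simp
  | succ n ih =>
    have key : ∑ j ∈ Finset.range (n + 1 + 1),
        (-1 : ℝ) ^ (n + 1 + j) * (((j + 1).factorial : ℝ) * dstirling lam (n + 1 + 1) (j + 1)) *
          (j.choose a : ℝ) = ∑ j ∈ Finset.range (n + 1),
        (-1 : ℝ) ^ (n + j) * (((j + 1).factorial : ℝ) * dstirling lam (n + 1) (j + 1)) *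
          ((a + 1) * ((j + 1).choose a : ℝ) + (n + 1) * lam * j.choose a) := by
      have distrib (s p q c : ℝ) : s * (p + q) * c = s * p * c + s * q * c := by ring
      simp only [factorial_mul_dstirling_succ_succ _ (n + 1), distrib, Finset.sum_add_distrib]
      rw [Finset.sum_range_succ', Finset.sum_range_succ _ (n + 1),
        dstirling_zero_right lam n.succ_ne_zero,
        dstirling_eq_zero_of_lt lam (show n + 1 < n + 1 + 1 by omega)]
      simp only [mul_zero, zero_mul, add_zero]
      rw [← Finset.sum_add_distrib]
      refine Finset.sum_congr rfl fun j _ => ?_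
      have h := add_one_mul_choose_add_add_one_mul_choose_succ j a
      push_cast
      rw [show n + 1 + (j + 1) = n + j + 2 by omega, show n + 1 + j = n + j + 1 by omega,
        pow_add _ _ 2, pow_succ _ (n + j)]
      linear_combination (-(-1 : ℝ) ^ (n + j) *
        (((j + 1).factorial : ℝ) * dstirling lam (n + 1) (j + 1))) * h
    rw [key, factorial_mul_dstirling_succ_succ, ih]
    cases a with
    | zero =>
      rw [dstirling_zero_right _ n.succ_ne_zero, mul_zero, mul_zero, zero_add, Finset.mul_sum]
      refine Finset.sum_congr rfl fun j _ => ?_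
      simp
      ring
    | succ a =>
      rw [ih, Finset.mul_sum, Finset.mul_sum, ← Finset.sum_add_distrib]
      refine Finset.sum_congr rfl fun j _ => ?_
      rw [Nat.choose_succ_succ j a]
      push_cast
      ring

theorem dstirling_neg_lam_eq (lam : ℝ) (α n : ℕ) (h1 : 1 ≤ α) (h2 : α ≤ n) :
    (α.factorial : ℝ) * dstirling (-lam) n α =
      ∑ j ∈ Finset.Icc α n,
        (-1 : ℝ) ^ (n - j) * (j.factorial : ℝ) * dstirling lam n j *
          ((j - 1).choose (α - 1) : ℝ) := by
  obtain ⟨a, rfl⟩ := Nat.exists_eq_add_of_le' h1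
  obtain ⟨m, rfl⟩ := Nat.exists_eq_add_of_le' (h1.trans h2)
  have hsub : Finset.Icc a m ⊆ Finset.range (m + 1) := fun j hj => by
    simp only [Finset.mem_Icc, Finset.mem_range] at hj ⊢
    omega
  rw [factorial_mul_dstirling_neg_lam, ← Finset.sum_subset hsub,
    ← Finset.map_add_right_Icc, Finset.sum_map]
  · refine Finset.sum_congr rfl fun j hj => ?_
    have hjm : j ≤ m := (Finset.mem_Icc.mp hj).2
    have hs : (-1 : ℝ) ^ (m + j) = (-1) ^ (m - j) := by
      rw [show m + j = (m - j) + 2 * j by omega, pow_add, pow_mul]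
      simp
    simp only [addRightEmbedding_apply, Nat.add_sub_add_right, Nat.add_sub_cancel, hs]
    ring
  · intro j hj hja
    have : j < a := by
      simp only [Finset.mem_Icc, Finset.mem_range] at hj hja
      omega
    simp [Nat.choose_eq_zero_of_lt this]
end

section
/- Let λ be a real number and let n, j be nonnegative integers with n ≥ j. Then {n brace j}_λ = ∑_{α=0}^{n} C(n,α) · (−1)^{α+j} · {α brace j}_{−λ} · (j)_{n−α,λ}. -/
theorem dff_succ (lam x : ℝ) (n : ℕ) : dff lam x (n + 1) = dff lam x n * (x - n * lam) :=
  Finset.prod_range_succ _ n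

/-- Vandermonde convolution for degenerate falling factorials. -/
theorem dff_add (lam x y : ℝ) (n : ℕ) :
    dff lam (x + y) n =
      ∑ p ∈ Finset.HasAntidiagonal.antidiagonal n, (n.choose p.1 : ℝ) * (dff lam x p.1 * dff lam y p.2) := by
  induction n with
  | zero => simp [dff]
  | succ n ih =>
    rw [Finset.sum_antidiagonal_choose_succ_mul (fun a b => dff lam x a * dff lam y b),
      ← Finset.sum_add_distrib, dff_succ, ih, Finset.sum_mul]
    refine Finset.sum_congr rfl fun p hp => ?_
    have hpn := Finset.HasAntidiagonal.mem_antidiagonal.mp hp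
    have hn : (n : ℝ) = p.1 + p.2 := by exact_mod_cast hpn.symm
    rw [← Nat.choose_symm_of_eq_add hpn.symm, dff_succ, dff_succ, hn]
    ring

theorem neg_one_pow_mul_dff_neg (lam x : ℝ) (n : ℕ) :
    (-1) ^ n * dff (-lam) x n = dff lam (-x) n := by
  induction n with
  | zero => simp [dff]
  | succ n ih =>
    rw [dff_succ, dff_succ, ← ih]
    ring

theorem sum_choose_mul_neg_one_pow_mul_dff (lam x y : ℝ) (n : ℕ) :
    ∑ α ∈ Finset.range (n + 1),
        (n.choose α : ℝ) * (-1) ^ α * dff (-lam) x α * dff lam y (n - α) =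
      dff lam (y - x) n := by
  rw [sub_eq_neg_add, dff_add, Finset.Nat.sum_antidiagonal_eq_sum_range_succ_mk]
  refine Finset.sum_congr rfl fun α _ => ?_
  rw [← neg_one_pow_mul_dff_neg]
  ring

theorem dstirling_eq_alternating_sum (lam : ℝ) (n j : ℕ) (h : j ≤ n) :
    dstirling lam n j =
      ∑ α ∈ Finset.range (n + 1),
        (n.choose α : ℝ) * (-1) ^ (α + j) * dstirling (-lam) α j * dff lam (j : ℝ) (n - α) := by
  calc
    dstirling lam n j
    _ = (1 / (j.factorial : ℝ)) * ∑ i ∈ Finset.range (j + 1),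
          (j.choose i : ℝ) * (-1) ^ (j - i) * (-1) ^ j * dff lam ((j : ℝ) - i) n := by
      rw [dstirling, ← Finset.sum_range_reflect]
      congr 1
      refine Finset.sum_congr rfl fun i hi => ?_
      have hij : i ≤ j := Nat.lt_succ_iff.mp (Finset.mem_range.mp hi)
      have hsign : (-1 : ℝ) ^ i = (-1) ^ (j - i) * (-1) ^ j := by
        obtain ⟨k, rfl⟩ := Nat.exists_eq_add_of_le hij
        rw [Nat.add_sub_cancel_left, pow_add, mul_left_comm, ← mul_pow]
        simp
      rw [Nat.add_sub_cancel, Nat.choose_symm hij, Nat.sub_sub_self hij, hsign,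
        Nat.cast_sub hij]
      ring
    _ = _ := by
      simp_rw [← sum_choose_mul_neg_one_pow_mul_dff, dstirling, Finset.mul_sum, Finset.sum_mul]
      rw [Finset.sum_comm]
      refine Finset.sum_congr rfl fun α _ => ?_
      refine Finset.sum_congr rfl fun i _ => ?_
      ring
end

section
/- Let λ and z be real numbers and let n, α be positive integers. Then ∑_{j=0}^{n} (−1)^j · C(n,j) · (z−j)_{n+α,λ} = ∑_{r=0}^{α} C(z−n, r) · (n+r)! · {n+α brace r+n}_λ, where C(z−n, r) is the generalized binomial coefficient with real upper argument z−n. -/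
open Polynomial in
/-- Newton's forward difference formula for a real polynomial. -/
theorem Polynomial.eval_eq_sum_gchoose_fwdDiff (Q : ℝ[X]) (d : ℕ)
    (hQ : ∀ r, d < r → (fwdDiff 1)^[r] Q.eval 0 = 0) (w : ℝ) :
    Q.eval w = ∑ r ∈ Finset.range (d + 1), gchoose w r * (fwdDiff 1)^[r] Q.eval 0 := by
  have gchoose_eq (x : ℝ) (r : ℕ) :
      gchoose x r = (descPochhammer ℝ r).eval x / r.factorial := by
    rw [gchoose, descPochhammer_eval_eq_prod_range]
  have gchoose_nat (m r : ℕ) : gchoose (m : ℝ) r = (m.choose r : ℝ) := by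
    rw [gchoose_eq, descPochhammer_eval_eq_descFactorial, Nat.descFactorial_eq_factorial_mul_choose,
      Nat.cast_mul, mul_div_cancel_left₀ _ (by positivity)]
  set S : ℝ[X] := ∑ r ∈ Finset.range (d + 1),
    C ((fwdDiff 1)^[r] Q.eval 0 / r.factorial) * descPochhammer ℝ r with hS
  have eval_S (x : ℝ) :
      S.eval x = ∑ r ∈ Finset.range (d + 1), gchoose x r * (fwdDiff 1)^[r] Q.eval 0 := by
    rw [hS, eval_finsetSum]
    refine Finset.sum_congr rfl fun r _ => ?_
    rw [gchoose_eq, eval_mul, eval_C]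
    ring
  have eq_at_nat (m : ℕ) : Q.eval (m : ℝ) = S.eval (m : ℝ) := by
    have newton := shift_eq_sum_fwdDiff_iter (1 : ℝ) Q.eval m 0
    simp only [nsmul_eq_mul, mul_one, zero_add] at newton
    rw [eval_S, newton]
    simp only [gchoose_nat]
    trans ∑ r ∈ Finset.range (max m d + 1), (m.choose r : ℝ) * (fwdDiff 1)^[r] Q.eval 0
    · refine Finset.sum_subset (Finset.range_mono (by omega)) fun r _ hr => ?_
      rw [Nat.choose_eq_zero_of_lt (by simpa using hr), Nat.cast_zero, zero_mul]
    · refine (Finset.sum_subset (Finset.range_mono (by omega)) fun r _ hr => ?_).symm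
      rw [hQ r (by simpa using hr), mul_zero]
  have hQS : Q = S := eq_of_infinite_eval_eq Q S <|
    (Set.infinite_range_of_injective (Nat.cast_injective (R := ℝ))).mono <| by
      rintro _ ⟨m, rfl⟩
      exact eq_at_nat m
  rw [← eval_S, ← hQS]

open Polynomial in
/-- Iterated forward differences of a polynomial function are polynomial functions. -/
theorem Polynomial.exists_eval_eq_fwdDiff_iter (P : ℝ[X]) (n : ℕ) :
    ∃ Q : ℝ[X], Q.eval = (fwdDiff 1)^[n] P.eval := by
  induction n with
  | zero => exact ⟨P, rfl⟩
  | succ n ih =>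
    obtain ⟨Q, hQ⟩ := ih
    refine ⟨Q.comp (X + 1) - Q, ?_⟩
    rw [Function.iterate_succ_apply', ← hQ]
    ext x
    simp [fwdDiff]

open Polynomial in
/-- The degenerate falling factorial `(x)_{n,λ}` as a polynomial in `x`. -/
theorem exists_polynomial_eval_eq_dff (lam : ℝ) (n : ℕ) :
    ∃ P : ℝ[X], P.natDegree ≤ n ∧ ∀ x, P.eval x = dff lam x n := by
  refine ⟨∏ i ∈ Finset.range n, (X - C (i * lam)), ?_, fun x => ?_⟩
  · rw [natDegree_prod_of_monic _ _ fun i _ => monic_X_sub_C _]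
    simp only [natDegree_X_sub_C, Finset.sum_const, Finset.card_range, smul_eq_mul, mul_one, le_refl]
  · simp [dff, eval_prod]

theorem factorial_mul_dstirling_s6 (lam : ℝ) (n k : ℕ) :
    (k.factorial : ℝ) * dstirling lam n k = (fwdDiff 1)^[k] (fun x => dff lam x n) 0 := by
  rw [dstirling, ← mul_assoc, mul_one_div_cancel (by positivity), one_mul,
    fwdDiff_iter_eq_sum_shift]
  refine Finset.sum_congr rfl fun j _ => ?_
  simp [mul_comm]

theorem alternating_sum_eq_fwdDiff_iter (f : ℝ → ℝ) (n : ℕ) (z : ℝ) :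
    ∑ j ∈ Finset.range (n + 1), (-1 : ℝ) ^ j * (n.choose j : ℝ) * f (z - j) =
      (fwdDiff 1)^[n] f (z - n) := by
  rw [fwdDiff_iter_eq_sum_shift, ← Finset.sum_range_reflect]
  refine Finset.sum_congr rfl fun j hj => ?_
  have hjn : j ≤ n := by simpa [Nat.lt_succ_iff] using hj
  rw [show n + 1 - 1 - j = n - j by omega, Nat.choose_symm hjn, Nat.cast_sub hjn]
  simp [sub_sub_eq_add_sub, sub_add_eq_add_sub]

theorem alternating_sum_dff_shift (lam z : ℝ) (n α : ℕ) (hn : 0 < n) (hα : 0 < α) :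
    ∑ j ∈ Finset.range (n + 1), (-1 : ℝ) ^ j * (n.choose j : ℝ) * dff lam (z - j) (n + α) =
      ∑ r ∈ Finset.range (α + 1),
        gchoose (z - n) r * ((n + r).factorial : ℝ) * dstirling lam (n + α) (r + n) := by
  obtain ⟨P, hdeg, hP⟩ := exists_polynomial_eval_eq_dff lam (n + α)
  obtain ⟨Q, hQ⟩ := P.exists_eval_eq_fwdDiff_iter n
  have hPfun : (fun x => dff lam x (n + α)) = fun x => P.eval x := funext fun x => (hP x).symm
  have iter_Q (r : ℕ) : (fwdDiff 1)^[r] (fun x => Q.eval x) =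
      (fwdDiff 1)^[r + n] (fun x => P.eval x) := by
    rw [Function.iterate_add_apply, ← hQ]
  rw [alternating_sum_eq_fwdDiff_iter (fun x => dff lam x (n + α)), hPfun, ← hQ]
  refine (Q.eval_eq_sum_gchoose_fwdDiff α ?_ (z - n)).trans ?_
  · intro r hr
    rw [iter_Q, Polynomial.fwdDiff_iter_eq_zero_of_degree_lt (by omega), Pi.zero_apply]
  · refine Finset.sum_congr rfl fun r _ => ?_
    rw [mul_assoc, add_comm n r, factorial_mul_dstirling_s6, hPfun, iter_Q]
end

section
/- Let λ and x be real numbers, let n be a nonnegative integer and let r be a positive integer. Then ∑_{k=0}^{n} C(x+k, k) · (k)_{r,λ} = ∑_{j=0}^{r} C(x+j, j) · C(x+n+1, n−j) · j! · {r brace j}_λ, where all binomial coefficients with real upper arguments are generalized binomial coefficients. -/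
open Finset Polynomial fwdDiff in
/-- Newton's forward difference expansion of the degenerate falling factorial. -/
theorem dff_natCast_eq_sum (lam : ℝ) (k r : ℕ) :
    dff lam (k : ℝ) r =
      ∑ j ∈ range (r + 1), (k.choose j : ℝ) * ((j.factorial : ℝ) * dstirling lam r j) := by
  set P : ℝ[X] := ∏ i ∈ range r, (X - C ((i : ℝ) * lam)) with hP
  have hPeval (y : ℝ) : P.eval y = dff lam y r := by simp [hP, dff, eval_prod]
  have hdeg : P.natDegree = r := by
    rw [hP, natDegree_prod_of_monic _ _ fun i _ => monic_X_sub_C _]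
    simp only [natDegree_X_sub_C, sum_const, card_range, smul_eq_mul, mul_one]
  have hdiff (j : ℕ) : (Δ_[1])^[j] P.eval 0 = (j.factorial : ℝ) * dstirling lam r j := by
    have hj : (j.factorial : ℝ) ≠ 0 := by positivity
    rw [fwdDiff_iter_eq_sum_shift, dstirling, ← mul_assoc, mul_one_div_cancel hj, one_mul]
    refine sum_congr rfl fun i _ => ?_
    simp only [hPeval, zero_add, nsmul_eq_mul, mul_one, zsmul_eq_mul]
    push_cast
    ring
  have hzero (j : ℕ) (hj : r < j) : (j.factorial : ℝ) * dstirling lam r j = 0 := by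
    rw [← hdiff, fwdDiff_iter_eq_zero_of_degree_lt (hdeg.trans_lt hj)]
    rfl
  have hshift : dff lam (k : ℝ) r =
      ∑ j ∈ range (k + 1), (k.choose j : ℝ) * ((j.factorial : ℝ) * dstirling lam r j) := by
    have := shift_eq_sum_fwdDiff_iter (1 : ℝ) P.eval k 0
    rw [zero_add, nsmul_one, hPeval] at this
    rw [this]
    refine sum_congr rfl fun j _ => ?_
    rw [hdiff, nsmul_eq_mul]
  rw [hshift]
  rcases le_total k r with h | h
  · refine sum_subset (range_mono (by omega)) fun j _ hj => ?_
    rw [Nat.choose_eq_zero_of_lt (by simpa using hj)]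
    simp
  · refine (sum_subset (range_mono (by omega)) fun j _ hj => ?_).symm
    rw [hzero j (by simpa using hj), mul_zero]

theorem gchoose_succ_succ (x : ℝ) (m : ℕ) :
    gchoose (x + 1) (m + 1) = gchoose x m + gchoose x (m + 1) := by
  have hprod : ∏ i ∈ Finset.range (m + 1), (x + 1 - (i : ℕ)) =
      (∏ i ∈ Finset.range m, (x - (i : ℕ))) * (x + 1) := by
    simp [Finset.prod_range_succ']
  have hm : (m.factorial : ℝ) ≠ 0 := by positivity
  rw [gchoose, gchoose, gchoose, hprod, Finset.prod_range_succ, Nat.factorial_succ]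
  push_cast
  field_simp
  ring

theorem gchooseZ_natCast (x : ℝ) (m : ℕ) : gchooseZ x m = gchoose x m := by
  simp [gchooseZ]

theorem gchooseZ_of_neg (x : ℝ) {m : ℤ} (hm : m < 0) : gchooseZ x m = 0 :=
  if_neg hm.not_ge

theorem gchooseZ_add_one (x : ℝ) (m : ℤ) :
    gchooseZ (x + 1) (m + 1) = gchooseZ x m + gchooseZ x (m + 1) := by
  rcases lt_trichotomy m (-1) with h | rfl | h
  · simp [gchooseZ_of_neg _ (show m < 0 by omega), gchooseZ_of_neg _ (show m + 1 < 0 by omega)]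
  · simp [gchooseZ, gchoose]
  · lift m to ℕ using by omega
    exact_mod_cast gchoose_succ_succ x m

theorem gchoose_add_mul_choose (x : ℝ) (k j : ℕ) :
    gchoose (x + k) k * (k.choose j : ℝ) =
      gchoose (x + j) j * gchooseZ (x + k) ((k : ℤ) - (j : ℤ)) := by
  rcases lt_or_ge k j with h | h
  · simp [Nat.choose_eq_zero_of_lt h, gchooseZ_of_neg _ (show (k : ℤ) - j < 0 by omega)]
  · obtain ⟨i, rfl⟩ := Nat.exists_eq_add_of_le' h
    have hsub : ((i + j : ℕ) : ℤ) - (j : ℤ) = (i : ℕ) := by push_cast; ring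
    have hprod : ∏ a ∈ Finset.range (i + j), (x + (i + j : ℕ) - (a : ℕ)) =
        (∏ a ∈ Finset.range i, (x + (i + j : ℕ) - (a : ℕ))) *
          ∏ a ∈ Finset.range j, (x + j - (a : ℕ)) := by
      rw [Finset.prod_range_add]
      congr 1
      refine Finset.prod_congr rfl fun a _ => ?_
      push_cast
      ring
    rw [hsub, gchooseZ_natCast, gchoose, gchoose, gchoose, hprod, ← Nat.choose_symm_add,
      Nat.cast_add_choose]
    field_simp

theorem sum_gchoose_mul_choose (x : ℝ) (n j : ℕ) :
    ∑ k ∈ Finset.range (n + 1), gchoose (x + k) k * (k.choose j : ℝ) =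
      gchoose (x + j) j * gchooseZ (x + n + 1) ((n : ℤ) - (j : ℤ)) := by
  induction n with
  | zero =>
    rw [zero_add, Finset.sum_range_one, gchoose_add_mul_choose]
    rcases j.eq_zero_or_pos with rfl | hj
    · simp [gchooseZ, gchoose]
    · simp [gchooseZ, hj.ne']
  | succ n ih =>
    rw [Finset.sum_range_succ, ih, gchoose_add_mul_choose, ← mul_add]
    have h := gchooseZ_add_one (x + n + 1) ((n : ℤ) - j)
    rw [show (n : ℤ) - j + 1 = ((n + 1 : ℕ) : ℤ) - j by push_cast; ring] at h
    push_cast at h ⊢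
    rw [← add_assoc, h]

theorem sum_gchoose_dff_eq (lam x : ℝ) (n : ℕ) (r : ℕ) (hr : 0 < r) :
    ∑ k ∈ Finset.range (n + 1), gchoose (x + k) k * dff lam (k : ℝ) r =
      ∑ j ∈ Finset.range (r + 1),
        gchoose (x + j) j * gchooseZ (x + n + 1) ((n : ℤ) - (j : ℤ)) * (j.factorial : ℝ) *
          dstirling lam r j := by
  simp_rw [dff_natCast_eq_sum, Finset.mul_sum]
  rw [Finset.sum_comm]
  refine Finset.sum_congr rfl fun j _ => ?_
  rw [← sum_gchoose_mul_choose, Finset.sum_mul, Finset.sum_mul]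
  refine Finset.sum_congr rfl fun k _ => ?_
  ring
end

section
/- Let λ be a real number, let x be a real number with x ≠ −1, and let n, r be nonnegative integers. Then T_n(x, r|λ) = (1+x)^n · ∑_{j=0}^{r} (−1)^j · C(n, j) · (x/(1+x))^j · ∑_{k=0}^{j} (−1)^k · C(j, k) · (k)_{r,λ}, where T_n(x, r|λ) = ∑_{k=0}^{n} C(n, k) · x^k · (k)_{r,λ} and C denotes the usual binomial coefficient. -/
/-- Expanding `(1 + x • S) ^ n = ((1 + x) + x • Δ) ^ n`, with `S` the shift and `Δ` the forward
difference, by the binomial theorem on both sides. -/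
theorem sum_choose_mul_pow_mul_shift {M R : Type*} [AddCommMonoid M] [CommRing R] (h : M)
    (f : M → R) (x : R) (n : ℕ) (y : M) :
    ∑ k ∈ Finset.range (n + 1), (n.choose k : R) * x ^ k * f (y + k • h) =
      ∑ j ∈ Finset.range (n + 1),
        (n.choose j : R) * x ^ j * (1 + x) ^ (n - j) * ((fwdDiff h)^[j] f) y := by
  let D : Module.End R (M → R) :=
    { toFun := fwdDiff h
      map_add' := fwdDiff_add h
      map_smul' := fwdDiff_const_smul h }
  have hD (k : ℕ) (g : M → R) (z : M) : (D ^ k) g z = ((fwdDiff h)^[k] g) z := by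
    rw [Module.End.pow_apply]; rfl
  have hS (k : ℕ) (g : M → R) (z : M) : ((D + 1) ^ k) g z = g (z + k • h) := by
    induction k generalizing z with
    | zero => simp
    | succ k ih =>
      have : ((D + 1) ^ (k + 1)) g z = ((D + 1) ^ k) g (z + h) := by
        rw [pow_succ', Module.End.mul_apply]
        exact sub_add_cancel _ _
      rw [this, ih, succ_nsmul', add_assoc]
  have key : (x • (D + 1) + 1) ^ n = (x • D + (1 + x) • (1 : Module.End R (M → R))) ^ n := by
    congr 1
    module
  rw [(Commute.one_right _).add_pow, ((Commute.one_right _).smul_right _).add_pow] at key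
  have := congrFun (LinearMap.congr_fun key f) y
  simp only [smul_pow, one_pow, mul_one, LinearMap.sum_apply, Finset.sum_apply, mul_smul_comm,
    ← nsmul_eq_mul', LinearMap.smul_apply, Pi.smul_apply, hD, hS, smul_eq_mul] at this
  simp only [nsmul_eq_mul] at this
  convert this using 2 <;> ring

open Polynomial in
theorem exists_natDegree_le_eval_eq_dff (lam : ℝ) (r : ℕ) :
    ∃ P : ℝ[X], P.natDegree ≤ r ∧ P.eval = fun y ↦ dff lam y r := by
  refine ⟨∏ i ∈ Finset.range r, (X - C (i * lam)), ?_, ?_⟩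
  · rw [natDegree_finsetProd_X_sub_C_eq_card, Finset.card_range]
  · ext y
    simp [dff, eval_prod]

theorem fwdDiff_iter_dff_eq_zero (lam : ℝ) {r j : ℕ} (h : r < j) :
    (fwdDiff 1)^[j] (fun y ↦ dff lam y r) = 0 := by
  obtain ⟨P, hP, hPe⟩ := exists_natDegree_le_eval_eq_dff lam r
  rw [← hPe]
  exact Polynomial.fwdDiff_iter_eq_zero_of_degree_lt (hP.trans_lt h)

theorem neg_one_pow_mul_sum_eq_fwdDiff_iter (f : ℝ → ℝ) (j : ℕ) :
    (-1 : ℝ) ^ j * ∑ k ∈ Finset.range (j + 1), (-1 : ℝ) ^ k * (j.choose k : ℝ) * f k =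
      ((fwdDiff 1)^[j] f) 0 := by
  rw [fwdDiff_iter_eq_sum_shift, Finset.mul_sum]
  refine Finset.sum_congr rfl fun k hk ↦ ?_
  obtain ⟨m, rfl⟩ := Nat.exists_eq_add_of_le (Finset.mem_range_succ_iff.mp hk)
  have hsq : (-1 : ℝ) ^ k * (-1) ^ k = 1 := by rw [← mul_pow]; simp
  simp only [Nat.add_sub_cancel_left, zsmul_eq_mul, nsmul_eq_mul, mul_one, zero_add]
  push_cast
  rw [pow_add]
  linear_combination (-1 : ℝ) ^ m * ((k + m).choose k : ℝ) * f k * hsq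

theorem T_explicit (lam x : ℝ) (hx : x ≠ -1) (n r : ℕ) :
    ∑ k ∈ Finset.range (n + 1), (n.choose k : ℝ) * x ^ k * dff lam (k : ℝ) r =
      (1 + x) ^ n *
        ∑ j ∈ Finset.range (r + 1),
          (-1 : ℝ) ^ j * (n.choose j : ℝ) * (x / (1 + x)) ^ j *
            ∑ k ∈ Finset.range (j + 1), (-1 : ℝ) ^ k * (j.choose k : ℝ) * dff lam (k : ℝ) r := by
  have hx' : 1 + x ≠ 0 := fun h ↦ hx (by linarith)
  set f : ℝ → ℝ := fun y ↦ dff lam y r with hf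
  have hL := sum_choose_mul_pow_mul_shift 1 f x n 0
  simp only [nsmul_eq_mul, mul_one, zero_add] at hL
  rw [hL, Finset.mul_sum]
  trans ∑ j ∈ Finset.range (n + r + 1),
    (n.choose j : ℝ) * x ^ j * (1 + x) ^ (n - j) * ((fwdDiff 1)^[j] f) 0
  · refine (Finset.eventually_constant_sum (fun j hj ↦ ?_) (by omega)).symm
    rw [Nat.choose_eq_zero_of_lt hj]
    simp
  · rw [Finset.eventually_constant_sum (N := r + 1) (fun j hj ↦ ?_) (by omega)]
    · refine Finset.sum_congr rfl fun j _ ↦ ?_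
      rw [← neg_one_pow_mul_sum_eq_fwdDiff_iter]
      rcases le_or_gt j n with hj | hj
      · rw [pow_sub₀ _ hx' hj, div_pow]
        ring
      · simp [Nat.choose_eq_zero_of_lt hj]
    · rw [hf, fwdDiff_iter_dff_eq_zero lam hj]
      simp
end
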